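/- Let 0 < β < 1 and p ≥ 2 satisfy 3/2 − β(1 − 1/p) > 1, and let w(x) = (1 + |x|²)^{−β/2}. Define, for f with ∫_ℝ |f(x)|^p w(x) dx < ∞, the operator T f(x) = ∫_ℝ (w(x) − w(y)) f(y) |x−y|^{−3/2} dy (absolutely convergent for almost every x). Then there exists C > 0 such that ∫_ℝ |T f(x)/w(x)|^p w(x) dx ≤ C^p ∫_ℝ |f(x)|^p w(x) dx for all such f; i.e. the map f ↦ (1/w) T f is bounded from L^p(w dx) to L^p(w dx). -/

import Mathlib

open MeasureTheory

/-- The weight `w_β(x) = (1 + |x|²)^{−β/2}`. -/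
noncomputable def wbeta (β x : ℝ) : ℝ := (1 + x ^ 2) ^ (-(β / 2))

/-- The commutator `[Λ^{1/2}, w_β] f` realized (up to a positive normalizing constant) by
`T f(x) = ∫ (w_β(x) − w_β(y)) f(y) |x−y|^{−3/2} dy`. -/
noncomputable def commWeightHalf (β : ℝ) (f : ℝ → ℝ) (x : ℝ) : ℝ :=
  ∫ y : ℝ, (wbeta β x - wbeta β y) * f y * |x - y| ^ (-(3 / 2 : ℝ))

open scoped ENNReal

lemma young_aux (k g : ℝ → ℝ≥0∞) (hk : Measurable k) (hg : Measurable g) (p : ℝ) (hp : 1 < p) :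
    ∫⁻ x, (∫⁻ y, k (x - y) * g y) ^ p ≤ (∫⁻ z, k z) ^ p * ∫⁻ y, g y ^ p := by
  have hp0 : 0 < p := by linarith
  have hpq : p.HolderConjugate (p.conjExponent) := Real.HolderConjugate.conjExponent hp
  set q := p.conjExponent with hq
  have hqp : q.HolderConjugate p := hpq.symm
  have hq0 : 0 < q := hqp.pos
  have hk1 : ∀ x, ∫⁻ y, k (x - y) = ∫⁻ z, k z := fun x => lintegral_sub_left_eq_self k x
  have hk2 : ∀ y, ∫⁻ x, k (x - y) = ∫⁻ z, k z := fun y => lintegral_sub_right_eq_self k y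
  have key : ∀ x, (∫⁻ y, k (x - y) * g y) ^ p ≤
      (∫⁻ z, k z) ^ (p - 1) * ∫⁻ y, k (x - y) * g y ^ p := by
    intro x
    have hkx : Measurable fun y => k (x - y) := hk.comp (measurable_const.sub measurable_id)
    have h := ENNReal.lintegral_mul_le_Lp_mul_Lq volume hqp
      (f := fun y => k (x - y) ^ (1 / q)) (g := fun y => k (x - y) ^ (1 / p) * g y)
      (hkx.pow_const _).aemeasurable ((hkx.pow_const _).mul hg).aemeasurable
    have e1 : ∀ y, ((fun y => k (x - y) ^ (1 / q)) * (fun y => k (x - y) ^ (1 / p) * g y)) y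
        = k (x - y) * g y := by
      intro y
      simp only [Pi.mul_apply]
      rw [← mul_assoc, ← ENNReal.rpow_add_of_nonneg _ _ (by positivity) (by positivity)]
      have : 1 / q + 1 / p = 1 := by
        have := hqp.inv_add_inv_eq_one
        simpa using this
      rw [this, ENNReal.rpow_one]
    have e2 : ∀ y, (k (x - y) ^ (1 / q)) ^ q = k (x - y) := by
      intro y
      rw [← ENNReal.rpow_mul, one_div_mul_cancel hq0.ne', ENNReal.rpow_one]
    have e3 : ∀ y, (k (x - y) ^ (1 / p) * g y) ^ p = k (x - y) * g y ^ p := by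
      intro y
      rw [ENNReal.mul_rpow_of_nonneg _ _ hp0.le, ← ENNReal.rpow_mul,
        one_div_mul_cancel hp0.ne', ENNReal.rpow_one]
    simp only [e1, e2, e3] at h
    rw [hk1] at h
    calc _ ≤ _ := ENNReal.rpow_le_rpow h hp0.le
      _ = _ := by
        rw [ENNReal.mul_rpow_of_nonneg _ _ hp0.le, ← ENNReal.rpow_mul, ← ENNReal.rpow_mul,
          one_div_mul_cancel hp0.ne', ENNReal.rpow_one]
        congr 2
        have := hqp.inv_add_inv_eq_one
        field_simp at this ⊢
        linarith
  have hm : Measurable (Function.uncurry fun x y => k (x - y) * g y ^ p) :=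
    (hk.comp (measurable_fst.sub measurable_snd)).mul ((hg.comp measurable_snd).pow_const _)
  calc _ ≤ ∫⁻ x, (∫⁻ z, k z) ^ (p - 1) * ∫⁻ y, k (x - y) * g y ^ p := lintegral_mono key
    _ = (∫⁻ z, k z) ^ (p - 1) * ∫⁻ x, ∫⁻ y, k (x - y) * g y ^ p :=
        lintegral_const_mul _ hm.lintegral_prod_right'
    _ = (∫⁻ z, k z) ^ (p - 1) * ∫⁻ y, ∫⁻ x, k (x - y) * g y ^ p := by
        rw [lintegral_lintegral_swap hm.aemeasurable]
    _ = (∫⁻ z, k z) ^ (p - 1) * ∫⁻ y, (∫⁻ z, k z) * g y ^ p := by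
        congr 2; ext y
        have hky : Measurable fun x => k (x - y) := hk.comp (measurable_id.sub measurable_const)
        rw [lintegral_mul_const _ hky, hk2]
    _ = (∫⁻ z, k z) ^ (p - 1) * ((∫⁻ z, k z) * ∫⁻ y, g y ^ p) := by
        rw [lintegral_const_mul _ (hg.pow_const _)]
    _ = _ := by
        rw [← mul_assoc]
        congr 1
        conv_lhs => rw [← ENNReal.rpow_one (∫⁻ z, k z), ← ENNReal.rpow_mul, one_mul,
          ← ENNReal.rpow_add_of_nonneg _ _ (by linarith) (by norm_num)]
        simp

/-- the convolution kernel -/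
noncomputable def kker (γ z : ℝ) : ℝ := (1 + |z|) ^ (γ - 1) * |z| ^ (-(1 / 2 : ℝ))

lemma kker_nonneg (γ z : ℝ) : 0 ≤ kker γ z := by unfold kker; positivity

lemma kker_meas (γ : ℝ) : Measurable (kker γ) := by unfold kker; fun_prop

lemma kker_int (γ : ℝ) (hγ : γ < 1 / 2) : Integrable (kker γ) := by
  have hpos : IntegrableOn (kker γ) (Set.Ioi 0) := by
    rw [← Set.Ioc_union_Ioi_eq_Ioi (zero_le_one' ℝ)]
    refine IntegrableOn.union ?_ ?_
    · have h : IntegrableOn (fun z : ℝ => z ^ (-(1 / 2 : ℝ))) (Set.Ioc 0 1) := by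
        rw [← intervalIntegrable_iff_integrableOn_Ioc_of_le zero_le_one]
        exact intervalIntegral.intervalIntegrable_rpow' (by norm_num)
      refine Integrable.mono' h (kker_meas γ).aestronglyMeasurable ?_
      refine (ae_restrict_iff' measurableSet_Ioc).2 (Filter.Eventually.of_forall fun z hz => ?_)
      rw [Real.norm_of_nonneg (kker_nonneg _ _)]
      unfold kker
      rw [abs_of_pos hz.1]
      have := hz.1
      have h1 : (1 + z) ^ (γ - 1) ≤ 1 :=
        Real.rpow_le_one_of_one_le_of_nonpos (by linarith) (by linarith)
      exact mul_le_of_le_one_left (by positivity) h1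
    · have h : IntegrableOn (fun z : ℝ => z ^ (γ - 3 / 2)) (Set.Ioi 1) :=
        integrableOn_Ioi_rpow_of_lt (by linarith) one_pos
      refine Integrable.mono' h (kker_meas γ).aestronglyMeasurable ?_
      refine (ae_restrict_iff' measurableSet_Ioi).2 (Filter.Eventually.of_forall fun z hz => ?_)
      have hz0 : 0 < z := lt_trans one_pos hz
      rw [Real.norm_of_nonneg (kker_nonneg _ _)]
      unfold kker
      rw [abs_of_pos hz0]
      have h1 : (1 + z) ^ (γ - 1) ≤ z ^ (γ - 1) :=
        Real.rpow_le_rpow_of_nonpos hz0 (by linarith) (by linarith)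
      calc _ ≤ z ^ (γ - 1) * z ^ (-(1 / 2 : ℝ)) := by gcongr
        _ = _ := by rw [← Real.rpow_add hz0]; congr 1; ring
  have e : (fun z => kker γ (-z)) = kker γ := by ext z; simp [kker]
  have hneg : IntegrableOn (kker γ) (Set.Iio 0) := by
    have h : IntegrableOn (kker γ) (Set.Ioi (-0)) := by simpa using hpos
    have h2 := h.comp_neg_Iio
    rwa [e] at h2
  rw [← integrableOn_univ, ← Set.Iic_union_Ioi (a := (0 : ℝ))]
  exact ((integrableOn_Iic_iff_integrableOn_Iio enorm_ne_top).2 hneg).union hpos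

lemma wbeta_pos (β x : ℝ) : 0 < wbeta β x := by unfold wbeta; positivity

lemma wbeta_meas (β : ℝ) : Measurable (wbeta β) := by unfold wbeta; fun_prop

lemma wbeta_ratio (β x y : ℝ) (hβ : 0 < β) : wbeta β x ≤ (1 + |x - y|) ^ β * wbeta β y := by
  unfold wbeta
  rw [Real.rpow_neg (by positivity), Real.rpow_neg (by positivity), ← div_eq_mul_inv,
    le_div_iff₀ (by positivity), inv_mul_eq_div, div_le_iff₀ (by positivity)]
  have h : 1 + y ^ 2 ≤ (1 + |x - y|) ^ (2:ℝ) * (1 + x ^ 2) := by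
    rw [Real.rpow_two]
    have h1 : -(x * (x - y)) ≤ |x| * |x - y| := by rw [← abs_mul]; exact neg_le_abs _
    have h2 : |x - y| ^ 2 = (x - y) ^ 2 := sq_abs _
    have h3 : |x| ^ 2 = x ^ 2 := sq_abs _
    nlinarith [abs_nonneg x, abs_nonneg (x - y), sq_nonneg (|x| - 1), mul_nonneg (abs_nonneg (x - y)) (sq_nonneg (|x| - 1)), mul_nonneg (sq_nonneg (x - y)) (sq_nonneg x), mul_nonneg (abs_nonneg (x - y)) (sq_nonneg x)]
  calc _ ≤ ((1 + |x - y|) ^ (2:ℝ) * (1 + x ^ 2)) ^ (β / 2) := by gcongr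
    _ = _ := by
      rw [Real.mul_rpow (by positivity) (by positivity), ← Real.rpow_mul (by positivity)]
      congr 2; ring

/-- one-sided bound -/
lemma core (β s a b z : ℝ) (hβ0 : 0 < β) (hβ1 : β < 1) (hs : 0 ≤ s) (ha : 0 < a)
    (hb : 0 < b) (hab : a ≤ b) (hz : 0 < z) (h : b ≤ (1 + z) ^ β * a) :
    (b - a) * z ^ (-(3 / 2 : ℝ)) ≤ b * (a / b) ^ s * ((1 + z) ^ (β * s - 1) * z ^ (-(1 / 2 : ℝ))) := by
  have h1 : (1 + z) ^ β ≤ 1 + z := by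
    calc _ ≤ (1 + z) ^ (1:ℝ) := Real.rpow_le_rpow_of_exponent_le (by linarith) hβ1.le
      _ = _ := Real.rpow_one _
  have h2 : b - a ≤ b * (z * (1 + z)⁻¹) := by
    have : b ≤ (1 + z) * a := h.trans (by gcongr)
    rw [← div_eq_mul_inv, ← mul_div_assoc, le_div_iff₀ (by linarith)]
    nlinarith
  have h3 : 1 ≤ (a / b) ^ s * (1 + z) ^ (β * s) := by
    rw [Real.rpow_mul (by positivity), ← Real.mul_rpow (by positivity) (by positivity)]
    apply Real.one_le_rpow _ hs
    rw [div_mul_eq_mul_div, one_le_div hb]; linarith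
  have e1 : z ^ (-(1 / 2 : ℝ)) = z * z ^ (-(3 / 2 : ℝ)) := by
    nth_rewrite 2 [← Real.rpow_one z]
    rw [← Real.rpow_add hz]; congr 1; norm_num
  have e2 : (1 + z) ^ (β * s - 1) = (1 + z) ^ (β * s) * (1 + z)⁻¹ := by
    rw [Real.rpow_sub (by positivity), Real.rpow_one, div_eq_mul_inv]
  rw [e1, e2]
  calc _ ≤ b * (z * (1 + z)⁻¹) * z ^ (-(3 / 2 : ℝ)) := by gcongr
    _ ≤ (b * (z * (1 + z)⁻¹) * z ^ (-(3 / 2 : ℝ))) * ((a / b) ^ s * (1 + z) ^ (β * s)) :=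
      le_mul_of_one_le_right (by positivity) h3
    _ = _ := by ring

lemma pointwise (β p x y : ℝ) (hβ0 : 0 < β) (hβ1 : β < 1) (hp : 2 ≤ p) :
    |wbeta β x - wbeta β y| * |x - y| ^ (-(3 / 2 : ℝ)) ≤
      wbeta β x ^ (1 - 1 / p) * (kker (β * (1 - 1 / p)) (x - y) * wbeta β y ^ (1 / p)) := by
  have hp1 : 1 / p ≤ 1 / 2 := one_div_le_one_div_of_le (by norm_num) hp
  have hp0 : 0 < 1 / p := by positivity
  have hwx := wbeta_pos β x
  have hwy := wbeta_pos β y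
  have hk := kker_nonneg (β * (1 - 1 / p)) (x - y)
  rcases eq_or_ne x y with rfl | hxy
  · simp only [sub_self, abs_zero, zero_mul]
    simp only [sub_self] at hk
    positivity
  have hz : 0 < |x - y| := abs_pos.2 (sub_ne_zero.2 hxy)
  set a := wbeta β x with ha
  set b := wbeta β y with hb
  rcases le_total a b with hab | hab
  · rw [abs_sub_comm, abs_of_nonneg (sub_nonneg.2 hab)]
    have h := wbeta_ratio β y x hβ0
    rw [abs_sub_comm] at h
    have := core β (1 - 1 / p) a b |x - y| hβ0 hβ1 (by linarith) hwx hwy hab hz h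
    refine this.trans (le_of_eq ?_)
    unfold kker
    have e : b * (a / b) ^ (1 - 1 / p) = a ^ (1 - 1 / p) * b ^ (1 / p) := by
      rw [Real.div_rpow hwx.le hwy.le, Real.rpow_sub hwy, Real.rpow_one]
      field_simp
    rw [e]; ring
  · rw [abs_of_nonneg (sub_nonneg.2 hab)]
    have h := wbeta_ratio β x y hβ0
    have := core β (1 / p) b a |x - y| hβ0 hβ1 (by linarith) hwy hwx hab hz h
    refine this.trans ?_
    unfold kker
    have e : a * (b / a) ^ (1 / p) = a ^ (1 - 1 / p) * b ^ (1 / p) := by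
      rw [Real.div_rpow hwy.le hwx.le, Real.rpow_sub hwx, Real.rpow_one]
      field_simp
    rw [e]
    have : (1 + |x - y|) ^ (β * (1 / p) - 1) ≤ (1 + |x - y|) ^ (β * (1 - 1 / p) - 1) := by
      apply Real.rpow_le_rpow_of_exponent_le (by linarith)
      nlinarith
    calc _ ≤ a ^ (1 - 1 / p) * b ^ (1 / p) * ((1 + |x - y|) ^ (β * (1 - 1 / p) - 1) * |x - y| ^ (-(1 / 2 : ℝ))) := by gcongr
      _ = _ := by ring

/-- For `0 < β < 1` and `p ≥ 2` with `3/2 − β(1 − 1/p) > 1`, the map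
`f ↦ (1/w_β) [Λ^{1/2}, w_β] f` is bounded from `L^p(w_β dx)` to `L^p(w_β dx)`,
the defining integral converging absolutely for almost every `x`. -/
theorem commutator_weight_half_bounded (β p : ℝ) (hβ0 : 0 < β) (hβ1 : β < 1)
    (hp : 2 ≤ p) (hcond : 1 < 3 / 2 - β * (1 - 1 / p)) :
    ∃ C > 0, ∀ f : ℝ → ℝ, Measurable f →
      Integrable (fun x : ℝ => |f x| ^ p * wbeta β x) →
      (∀ᵐ x : ℝ, Integrable (fun y : ℝ =>
          (wbeta β x - wbeta β y) * f y * |x - y| ^ (-(3 / 2 : ℝ)))) ∧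
      Integrable (fun x : ℝ => |commWeightHalf β f x / wbeta β x| ^ p * wbeta β x) ∧
      (∫ x : ℝ, |commWeightHalf β f x / wbeta β x| ^ p * wbeta β x) ≤
        C ^ p * ∫ x : ℝ, |f x| ^ p * wbeta β x := by
  have hp0 : 0 < p := by linarith
  set γ := β * (1 - 1 / p) with hγ
  set k : ℝ → ℝ≥0∞ := fun z => ENNReal.ofReal (kker γ z) with hkdef
  have hkm : Measurable k := (kker_meas γ).ennreal_ofReal
  set K := ∫⁻ z, k z with hK
  have hKfin : K < ∞ := (kker_int γ (by linarith)).lintegral_lt_top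
  refine ⟨K.toReal + 1, by positivity, fun f hf hfi => ?_⟩
  set g : ℝ → ℝ≥0∞ := fun y => ENNReal.ofReal (|f y| * wbeta β y ^ (1 / p)) with hgdef
  have hgm : Measurable g :=
    (hf.abs.mul ((wbeta_meas β).pow_const _)).ennreal_ofReal
  have hgp : ∀ y, g y ^ p = ENNReal.ofReal (|f y| ^ p * wbeta β y) := by
    intro y
    have hw := wbeta_pos β y
    simp only [hgdef]
    rw [ENNReal.ofReal_rpow_of_nonneg (by positivity) hp0.le,
      Real.mul_rpow (by positivity) (by positivity), ← Real.rpow_mul hw.le,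
      one_div_mul_cancel hp0.ne', Real.rpow_one]
  have hnn : ∀ h : ℝ → ℝ, ∀ y, 0 ≤ |h y| ^ p * wbeta β y := fun h y => by
    have := wbeta_pos β y
    positivity
  have hG : ∫⁻ y, g y ^ p = ENNReal.ofReal (∫ x : ℝ, |f x| ^ p * wbeta β x) := by
    simp only [hgp]
    rw [ofReal_integral_eq_lintegral_ofReal hfi (Filter.Eventually.of_forall (hnn f))]
  set A : ℝ → ℝ≥0∞ := fun x => ∫⁻ y, k (x - y) * g y with hA
  have hAm : Measurable A := by
    have : Measurable (Function.uncurry fun x y => k (x - y) * g y) :=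
      (hkm.comp (measurable_fst.sub measurable_snd)).mul (hgm.comp measurable_snd)
    exact this.lintegral_prod_right'
  have hY : ∫⁻ x, A x ^ p ≤ K ^ p * ENNReal.ofReal (∫ x : ℝ, |f x| ^ p * wbeta β x) := by
    rw [← hG]
    exact young_aux k g hkm hgm p (by linarith)
  have hYfin : K ^ p * ENNReal.ofReal (∫ x : ℝ, |f x| ^ p * wbeta β x) < ∞ :=
    ENNReal.mul_lt_top (ENNReal.rpow_lt_top_of_nonneg hp0.le hKfin.ne) ENNReal.ofReal_lt_top
  have hAfin : ∀ᵐ x, A x < ∞ := by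
    filter_upwards [ae_lt_top (hAm.pow_const p) (hY.trans_lt hYfin).ne] with x hx
    by_contra h
    rw [not_lt, top_le_iff] at h
    simp [h, hp0] at hx
  have hbd : ∀ x y, ‖(wbeta β x - wbeta β y) * f y * |x - y| ^ (-(3 / 2 : ℝ))‖ₑ ≤
      ENNReal.ofReal (wbeta β x ^ (1 - 1 / p)) * (k (x - y) * g y) := by
    intro x y
    have hwx := wbeta_pos β x
    have hwy := wbeta_pos β y
    have hk0 := kker_nonneg γ (x - y)
    simp only [hkdef, hgdef]
    rw [← ENNReal.ofReal_mul hk0, ← ENNReal.ofReal_mul (by positivity), ← ofReal_norm]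
    apply ENNReal.ofReal_le_ofReal
    rw [norm_mul, norm_mul, Real.norm_eq_abs, Real.norm_eq_abs, Real.norm_eq_abs,
      abs_of_nonneg (Real.rpow_nonneg (abs_nonneg (x - y)) _)]
    have := mul_le_mul_of_nonneg_right (pointwise β p x y hβ0 hβ1 hp) (abs_nonneg (f y))
    calc _ = |wbeta β x - wbeta β y| * |x - y| ^ (-(3 / 2 : ℝ)) * |f y| := by ring
      _ ≤ _ := this
      _ = _ := by rw [hγ]; ring
  have hlin : ∀ x, ∫⁻ y, ‖(wbeta β x - wbeta β y) * f y * |x - y| ^ (-(3 / 2 : ℝ))‖ₑ ≤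
      ENNReal.ofReal (wbeta β x ^ (1 - 1 / p)) * A x := by
    intro x
    refine (lintegral_mono (hbd x)).trans (le_of_eq ?_)
    exact lintegral_const_mul _ ((hkm.comp (measurable_const.sub measurable_id)).mul hgm)
  have hwm := wbeta_meas β
  have hjm : Measurable (Function.uncurry fun x y : ℝ =>
      (wbeta β x - wbeta β y) * f y * |x - y| ^ (-(3 / 2 : ℝ))) := by
    unfold Function.uncurry
    fun_prop
  have hTm : Measurable (commWeightHalf β f) :=
    (hjm.stronglyMeasurable.integral_prod_right).measurable
  have hpt : ∀ x, ENNReal.ofReal (|commWeightHalf β f x / wbeta β x| ^ p * wbeta β x) ≤ A x ^ p := by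
    intro x
    have hwx := wbeta_pos β x
    have h1 : ‖commWeightHalf β f x‖ₑ ≤ ENNReal.ofReal (wbeta β x ^ (1 - 1 / p)) * A x :=
      (enorm_integral_le_lintegral_enorm _).trans (hlin x)
    have e : |commWeightHalf β f x / wbeta β x| ^ p * wbeta β x =
        (wbeta β x ^ (-(1 - 1 / p)) * |commWeightHalf β f x|) ^ p := by
      rw [Real.mul_rpow (by positivity) (by positivity), abs_div, abs_of_pos hwx,
        Real.div_rpow (by positivity) hwx.le, ← Real.rpow_mul hwx.le]
      have : -(1 - 1 / p) * p = 1 - p := by field_simp; ring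
      rw [this, Real.rpow_sub hwx, Real.rpow_one]
      ring
    rw [e, ← ENNReal.ofReal_rpow_of_nonneg (by positivity) hp0.le]
    apply ENNReal.rpow_le_rpow _ hp0.le
    rw [ENNReal.ofReal_mul (by positivity), ← Real.norm_eq_abs, ofReal_norm]
    calc _ ≤ ENNReal.ofReal (wbeta β x ^ (-(1 - 1 / p))) *
          (ENNReal.ofReal (wbeta β x ^ (1 - 1 / p)) * A x) := by gcongr
      _ = A x := by
        rw [← mul_assoc, ← ENNReal.ofReal_mul (by positivity), ← Real.rpow_add hwx]
        simp
  have hfinal : ∫⁻ x, ENNReal.ofReal (|commWeightHalf β f x / wbeta β x| ^ p * wbeta β x) ≤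
      K ^ p * ENNReal.ofReal (∫ x : ℝ, |f x| ^ p * wbeta β x) := (lintegral_mono hpt).trans hY
  have hmeas : Measurable fun x => |commWeightHalf β f x / wbeta β x| ^ p * wbeta β x := by
    fun_prop
  have hnn2 := hnn (fun x => commWeightHalf β f x / wbeta β x)
  refine ⟨?_, ?_, ?_⟩
  · filter_upwards [hAfin] with x hx
    refine ⟨(hjm.comp measurable_prodMk_left).aestronglyMeasurable, ?_⟩
    exact (hlin x).trans_lt (ENNReal.mul_lt_top ENNReal.ofReal_lt_top hx)
  · refine ⟨hmeas.aestronglyMeasurable, ?_⟩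
    rw [hasFiniteIntegral_iff_ofReal (Filter.Eventually.of_forall hnn2)]
    exact hfinal.trans_lt hYfin
  · have hI : 0 ≤ ∫ x : ℝ, |f x| ^ p * wbeta β x := integral_nonneg (hnn f)
    rw [integral_eq_lintegral_of_nonneg_ae (Filter.Eventually.of_forall hnn2)
      hmeas.aestronglyMeasurable]
    calc _ ≤ _ := ENNReal.toReal_mono hYfin.ne hfinal
      _ = K.toReal ^ p * ∫ x : ℝ, |f x| ^ p * wbeta β x := by
        rw [ENNReal.toReal_mul, ENNReal.toReal_ofReal hI, ENNReal.toReal_rpow]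
      _ ≤ _ := by
        gcongr
        linarith
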